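/- Let f : [a,b] → ℝ (with 0 ∈ [a,b]) be continuous and matrix convex with f(0) ≤ 0. Then for any m×n complex matrices A and B with A*A + B*B ≤ Iₙ (in the Loewner order) and any self-adjoint m×m matrix T with spectrum in [a,b], one has f(A*TA + B*TB) ≤ A* f(T) A + B* f(T) B in the Loewner order (here A*TA + B*TB is self-adjoint with spectrum in [a,b]). -/

import Mathlib

open Matrix
open scoped ComplexOrder

/-- `f` is matrix convex on `[a,b]`: for every size `k`, the map `T ↦ f(T)` (continuous
functional calculus) is convex, in the Loewner order, on the self-adjoint `k × k` complex
matrices with spectrum contained in `[a,b]`. -/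
def IsMatrixConvexOn (a b : ℝ) (f : ℝ → ℝ) : Prop :=
  ∀ (k : ℕ) (S T : Matrix (Fin k) (Fin k) ℂ), S.IsHermitian → T.IsHermitian →
    spectrum ℝ S ⊆ Set.Icc a b → spectrum ℝ T ⊆ Set.Icc a b →
    ∀ c : ℝ, 0 ≤ c → c ≤ 1 →
      (c • cfc f S + (1 - c) • cfc f T - cfc f (c • S + (1 - c) • T)).PosSemidef

namespace Matrix

variable {ι κ : Type*} [Fintype ι] [DecidableEq ι] [Fintype κ] [DecidableEq κ]

/-- On two Hermitian matrices, the functional calculus of `f` is evaluation of one common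
polynomial. -/
lemma exists_polynomial_cfc_eq (f : ℝ → ℝ) {S : Matrix ι ι ℂ} {T : Matrix κ κ ℂ}
    (hS : S.IsHermitian) (hT : T.IsHermitian) :
    ∃ p : Polynomial ℝ, cfc f S = Polynomial.aeval S p ∧ cfc f T = Polynomial.aeval T p := by
  classical
  have hfin : (spectrum ℝ S ∪ spectrum ℝ T).Finite :=
    S.finite_real_spectrum.union T.finite_real_spectrum
  have hp : ∀ x ∈ spectrum ℝ S ∪ spectrum ℝ T,
      f x = (Lagrange.interpolate hfin.toFinset id f).eval x := fun x hx =>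
    (Lagrange.eval_interpolate_at_node f (Set.injOn_id _) (hfin.mem_toFinset.mpr hx)).symm
  refine ⟨Lagrange.interpolate hfin.toFinset id f, ?_, ?_⟩
  · rw [← cfc_polynomial _ S hS]
    exact cfc_congr fun x hx => hp x (.inl hx)
  · rw [← cfc_polynomial _ T hT]
    exact cfc_congr fun x hx => hp x (.inr hx)

lemma aeval_mul_eq_mul_aeval {S : Matrix ι ι ℂ} {T : Matrix κ κ ℂ} {X : Matrix ι κ ℂ}
    (h : S * X = X * T) (p : Polynomial ℝ) :
    Polynomial.aeval S p * X = X * Polynomial.aeval T p := by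
  induction p using Polynomial.induction_on with
  | C r => simp [Algebra.algebraMap_eq_smul_one]
  | add p q hp hq => simp [Matrix.add_mul, Matrix.mul_add, hp, hq]
  | monomial k r ih =>
    rw [pow_succ, ← mul_assoc, map_mul _ _ Polynomial.X,
      map_mul _ _ Polynomial.X, Polynomial.aeval_X, Polynomial.aeval_X,
      Matrix.mul_assoc, h, ← Matrix.mul_assoc, ih, Matrix.mul_assoc]

/-- The functional calculus respects intertwining relations. -/
lemma cfc_mul_eq_mul_cfc (f : ℝ → ℝ) {S : Matrix ι ι ℂ} {T : Matrix κ κ ℂ} {X : Matrix ι κ ℂ}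
    (hS : S.IsHermitian) (hT : T.IsHermitian) (h : S * X = X * T) :
    cfc f S * X = X * cfc f T := by
  obtain ⟨p, hpS, hpT⟩ := exists_polynomial_cfc_eq f hS hT
  rw [hpS, hpT, aeval_mul_eq_mul_aeval h]

lemma cfc_reindexAlgEquiv (f : ℝ → ℝ) (e : ι ≃ κ) {S : Matrix ι ι ℂ} (hS : S.IsHermitian) :
    cfc f (reindexAlgEquiv ℝ ℂ e S) = reindexAlgEquiv ℝ ℂ e (cfc f S) := by
  obtain ⟨p, hpS, hpT⟩ := exists_polynomial_cfc_eq f hS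
    (show (reindexAlgEquiv ℝ ℂ e S).IsHermitian from hS.submatrix e.symm)
  rw [hpS, hpT, Polynomial.aeval_algHom_apply]

lemma cfc_fromBlocks_zero_zero (f : ℝ → ℝ) {S : Matrix ι ι ℂ} {T : Matrix κ κ ℂ}
    (hS : S.IsHermitian) (hT : T.IsHermitian) :
    cfc f (fromBlocks S 0 0 T) = fromBlocks (cfc f S) 0 0 (cfc f T) := by
  have hF : (fromBlocks S 0 0 T).IsHermitian := hS.fromBlocks (by simp) hT
  have h₁ := cfc_mul_eq_mul_cfc f hF hS (X := fromRows 1 0)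
    (by simp [fromBlocks_mul_fromRows, fromRows_mul])
  have h₂ := cfc_mul_eq_mul_cfc f hF hT (X := fromRows 0 1)
    (by simp [fromBlocks_mul_fromRows, fromRows_mul])
  rw [← Matrix.mul_one (cfc f (fromBlocks S 0 0 T)), ← fromBlocks_one,
    ← fromCols_fromRows_eq_fromBlocks 1, mul_fromCols, h₁, h₂, fromRows_mul, fromRows_mul,
    fromCols_fromRows_eq_fromBlocks]
  simp

lemma spectrum_fromBlocks_zero_zero (S : Matrix ι ι ℂ) (T : Matrix κ κ ℂ) :
    spectrum ℝ (fromBlocks S 0 0 T) = spectrum ℝ S ∪ spectrum ℝ T := by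
  ext r
  have h : algebraMap ℝ (Matrix (ι ⊕ κ) (ι ⊕ κ) ℂ) r - fromBlocks S 0 0 T =
      fromBlocks (algebraMap ℝ _ r - S) 0 0 (algebraMap ℝ _ r - T) := by
    simp [Algebra.algebraMap_eq_smul_one, ← fromBlocks_one, fromBlocks_smul, sub_eq_add_neg,
      fromBlocks_neg, fromBlocks_add]
  rw [Set.mem_union, spectrum.mem_iff, spectrum.mem_iff, spectrum.mem_iff, h,
    isUnit_fromBlocks_zero₂₁, not_and_or]

end Matrix

namespace IsMatrixConvexOn

variable {a b : ℝ} {f : ℝ → ℝ} {ι κ : Type*} [Fintype ι] [DecidableEq ι] [Fintype κ]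
  [DecidableEq κ]

/-- Midpoint matrix convexity over an arbitrary finite index type. -/
lemma midpoint_posSemidef (hconv : IsMatrixConvexOn a b f) {S T : Matrix ι ι ℂ}
    (hS : S.IsHermitian) (hT : T.IsHermitian) (hSspec : spectrum ℝ S ⊆ Set.Icc a b)
    (hTspec : spectrum ℝ T ⊆ Set.Icc a b) :
    ((1 / 2 : ℝ) • (cfc f S + cfc f T) - cfc f ((1 / 2 : ℝ) • (S + T))).PosSemidef := by
  let e := Fintype.equivFin ι
  let φ := reindexAlgEquiv ℝ ℂ e
  have h := hconv _ (φ S) (φ T) (hS.submatrix e.symm) (hT.submatrix e.symm)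
    (by rwa [AlgEquiv.spectrum_eq]) (by rwa [AlgEquiv.spectrum_eq]) (1 / 2) (by norm_num)
    (by norm_num)
  have hST : ((1 / 2 : ℝ) • (S + T)).IsHermitian := by
    simp [IsHermitian, hS.eq, hT.eq]
  rw [show (1 - 1 / 2 : ℝ) = 1 / 2 by norm_num, ← smul_add, ← smul_add, ← map_add, ← map_smul,
    cfc_reindexAlgEquiv f e hS, cfc_reindexAlgEquiv f e hT, cfc_reindexAlgEquiv f e hST,
    ← map_add, ← map_smul, ← map_sub] at h
  simpa [coe_reindexAlgEquiv] using h.submatrix e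

/-- Jensen's inequality for the compression by an isometry. -/
lemma isometry_posSemidef (hconv : IsMatrixConvexOn a b f) {X : Matrix ι κ ℂ} (hX : Xᴴ * X = 1)
    {S : Matrix ι ι ℂ} (hS : S.IsHermitian) (hSspec : spectrum ℝ S ⊆ Set.Icc a b) :
    (Xᴴ * cfc f S * X - cfc f (Xᴴ * S * X)).PosSemidef := by
  let U : Matrix ι ι ℂ := (2 : ℝ) • (X * Xᴴ) - 1
  have hUX : U * X = X := by
    rw [Matrix.sub_mul, Matrix.smul_mul, Matrix.mul_assoc, hX, Matrix.mul_one, Matrix.one_mul,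
      two_smul, add_sub_cancel_right]
  have hUh : Uᴴ = U := by simp [U]
  have hXU : Xᴴ * U = Xᴴ := by simpa [hUh] using congrArg conjTranspose hUX
  have hUU : U * U = 1 := by
    have : U * U = (2 : ℝ) • ((U * X) * Xᴴ) - U := by
      conv_lhs => rw [show U * U = U * ((2 : ℝ) • (X * Xᴴ) - 1) from rfl]
      simp [Matrix.mul_sub, Matrix.mul_assoc]
    rw [this, hUX]
    simp [U]
  have hV : (U * S * U).IsHermitian := by
    simpa [hUh] using isHermitian_conjTranspose_mul_mul U hS
  have hVspec : spectrum ℝ (U * S * U) ⊆ Set.Icc a b := by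
    have := spectrum.units_conjugate (R := ℝ) (a := S) (u := ⟨U, U, hUU, hUU⟩)
    simpa using this.trans_subset hSspec
  have hVcfc : cfc f (U * S * U) = U * cfc f S * U := by
    have := cfc_mul_eq_mul_cfc f hV hS (X := U) (by rw [Matrix.mul_assoc, hUU, Matrix.mul_one])
    rw [← this, Matrix.mul_assoc _ U U, hUU, Matrix.mul_one]
  have hD : ((1 / 2 : ℝ) • (S + U * S * U)).IsHermitian := by
    simp [IsHermitian, hS.eq, hV.eq]
  have hY : (Xᴴ * S * X).IsHermitian := isHermitian_conjTranspose_mul_mul X hS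
  have hDX : ((1 / 2 : ℝ) • (S + U * S * U)) * X = X * (Xᴴ * S * X) := by
    rw [Matrix.smul_mul, Matrix.add_mul, Matrix.mul_assoc _ U X, hUX]
    simp only [U, Matrix.sub_mul, Matrix.smul_mul, Matrix.one_mul, Matrix.mul_assoc,
      add_sub_cancel, smul_smul]
    norm_num
  have h := (hconv.midpoint_posSemidef hS hV hSspec hVspec).conjTranspose_mul_mul_same X
  rw [Matrix.mul_sub, Matrix.sub_mul, Matrix.mul_assoc _ (cfc f ((1 / 2 : ℝ) • _)),
    cfc_mul_eq_mul_cfc f hD hY hDX, ← Matrix.mul_assoc, hX, Matrix.one_mul, hVcfc] at h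
  convert h using 2
  simp only [Matrix.mul_smul, Matrix.smul_mul, Matrix.mul_add, Matrix.add_mul]
  rw [Matrix.mul_assoc U, ← Matrix.mul_assoc Xᴴ U, hXU, Matrix.mul_assoc _ (_ * U),
    Matrix.mul_assoc _ U, hUX, ← Matrix.mul_assoc, ← two_smul ℝ, smul_smul]
  norm_num

/-- Jensen's inequality for the compression by a contraction, when `f 0 ≤ 0`. -/
lemma contraction_posSemidef (hconv : IsMatrixConvexOn a b f) (h0mem : (0 : ℝ) ∈ Set.Icc a b)
    (hf0 : f 0 ≤ 0) {K : Matrix ι κ ℂ} (hK : (1 - Kᴴ * K).PosSemidef)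
    {S : Matrix ι ι ℂ} (hS : S.IsHermitian) (hSspec : spectrum ℝ S ⊆ Set.Icc a b) :
    (Kᴴ * cfc f S * K - cfc f (Kᴴ * S * K)).PosSemidef := by
  obtain ⟨C, hC⟩ : ∃ C : Matrix κ κ ℂ, 1 - Kᴴ * K = Cᴴ * C := by
    open scoped MatrixOrder Norms.L2Operator in
    exact CStarAlgebra.nonneg_iff_eq_star_mul_self.mp hK.nonneg
  have hX : (fromRows K C)ᴴ * fromRows K C = 1 := by
    rw [conjTranspose_fromRows_eq_fromCols_conjTranspose, fromCols_mul_fromRows, ← hC,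
      add_sub_cancel]
  have hspec : spectrum ℝ (fromBlocks S 0 0 (0 : Matrix κ κ ℂ)) ⊆ Set.Icc a b := by
    rw [spectrum_fromBlocks_zero_zero]
    refine Set.union_subset hSspec ?_
    cases isEmpty_or_nonempty κ
    · simp [spectrum.of_subsingleton]
    · simpa [spectrum.zero_eq] using h0mem
  have h := hconv.isometry_posSemidef hX (hS.fromBlocks (by simp) isHermitian_zero) hspec
  rw [cfc_fromBlocks_zero_zero f hS isHermitian_zero, cfc_apply_zero,
    conjTranspose_fromRows_eq_fromCols_conjTranspose, Matrix.mul_assoc, Matrix.mul_assoc,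
    fromBlocks_mul_fromRows, fromBlocks_mul_fromRows, fromCols_mul_fromRows,
    fromCols_mul_fromRows] at h
  have hneg : ((-f 0) • (Cᴴ * C)).PosSemidef :=
    (posSemidef_conjTranspose_mul_self C).smul (neg_nonneg.mpr hf0)
  convert h.add hneg using 1
  simp only [Algebra.algebraMap_eq_smul_one, Matrix.zero_mul, Matrix.mul_zero, add_zero, zero_add,
    Matrix.smul_mul, Matrix.mul_smul, Matrix.one_mul, Matrix.mul_assoc, neg_smul]
  abel

end IsMatrixConvexOn

/-- Hansen–Pedersen Jensen inequality, contractive version: if `f` is continuous and matrix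
convex on `[a,b] ∋ 0` with `f 0 ≤ 0`, `A` and `B` are `m × n` matrices with `AᴴA + BᴴB ≤ 1`
in the Loewner order, and `T` is self-adjoint with spectrum in `[a,b]`, then
`f(AᴴTA + BᴴTB) ≤ Aᴴ f(T) A + Bᴴ f(T) B` in the Loewner order. -/
theorem hansen_pedersen_jensen_contractive {a b : ℝ} (f : ℝ → ℝ)
    (hf : ContinuousOn f (Set.Icc a b))
    (h0mem : (0 : ℝ) ∈ Set.Icc a b) (hf0 : f 0 ≤ 0)
    (hconv : IsMatrixConvexOn a b f)
    {m n : ℕ} (A B : Matrix (Fin m) (Fin n) ℂ)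
    (hAB : ((1 : Matrix (Fin n) (Fin n) ℂ) - (Aᴴ * A + Bᴴ * B)).PosSemidef)
    (T : Matrix (Fin m) (Fin m) ℂ) (hT : T.IsHermitian)
    (hTspec : spectrum ℝ T ⊆ Set.Icc a b) :
    (Aᴴ * cfc f T * A + Bᴴ * cfc f T * B
      - cfc f (Aᴴ * T * A + Bᴴ * T * B)).PosSemidef := by
  have h := hconv.contraction_posSemidef h0mem hf0 (K := fromRows A B)
    (by rwa [conjTranspose_fromRows_eq_fromCols_conjTranspose, fromCols_mul_fromRows])
    (hT.fromBlocks (conjTranspose_zero (m := Fin m) (n := Fin m)) hT)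
    (by rw [spectrum_fromBlocks_zero_zero]; exact Set.union_subset hTspec hTspec)
  rw [cfc_fromBlocks_zero_zero f hT hT, conjTranspose_fromRows_eq_fromCols_conjTranspose,
    Matrix.mul_assoc, Matrix.mul_assoc, fromBlocks_mul_fromRows, fromBlocks_mul_fromRows,
    fromCols_mul_fromRows, fromCols_mul_fromRows] at h
  simpa [Matrix.mul_assoc] using h
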